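/- Let (G, ω) be a vertex-weighted graph and v, w distinct non-adjacent vertices. The map sending a proper set coloring κ of G in which the three sets κ(v) ∩ κ(w), κ(v) \ κ(w), and κ(w) \ κ(v) are all nonempty to the coloring κ^⋆ of G^⋆ defined by κ^⋆(z^⋆) = κ(v) ∩ κ(w), κ^⋆(v) = κ(v) \ κ(w), κ^⋆(w) = κ(w) \ κ(v), and κ^⋆(u) = κ(u) otherwise is a bijection from such colorings of G to all proper set colorings of G^⋆, and it preserves the associated monomial: Π_{u ∈ V(G)} (Π_{i ∈ κ(u)} x_i)^{ω(u)} = Π_{u ∈ V(G^⋆)} (Π_{i ∈ κ^⋆(u)} x_i)^{ω^⋆(u)}. -/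

import Mathlib

open scoped Classical

noncomputable section

/-- A proper set coloring assigns to each vertex a nonempty finite set of colors
(positive integers, here indexed by `ℕ`) such that adjacent vertices get disjoint sets. -/
def IsProperSetColoring {V : Type*} (G : SimpleGraph V) (κ : V → Finset ℕ) : Prop :=
  (∀ v, (κ v).Nonempty) ∧ ∀ ⦃u v : V⦄, G.Adj u v → Disjoint (κ u) (κ v)

/-- The exponent vector of the monomial `∏_v (∏_{i ∈ κ v} x_i)^(ω v)`. -/
def setColWeight {V : Type*} [Fintype V] (ω : V → ℕ) (κ : V → Finset ℕ) : ℕ →₀ ℕ :=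
  ∑ v : V, ω v • (κ v).sum (fun i => Finsupp.single i 1)

/-- The (vertex-weighted) Kromatic symmetric function, as a power series in
`x_0, x_1, x_2, …`: the coefficient of a monomial is the number of proper set
colorings producing that monomial. -/
def kromatic {V : Type*} [Fintype V] (G : SimpleGraph V) (ω : V → ℕ) :
    MvPowerSeries ℕ ℤ :=
  fun d => (Nat.card {κ : V → Finset ℕ //
    IsProperSetColoring G κ ∧ setColWeight ω κ = d} : ℤ)

/-- `G^⋆`: the graph with vertex set `V(G) ∪ {z⋆}` (the new vertex `z⋆` is `none`) and
edge set `E(G) ∪ {vw, vz⋆, wz⋆} ∪ {z⋆u : u ∈ N(v) ∪ N(w)}`. -/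
def Gstar {V : Type*} (G : SimpleGraph V) (v w : V) : SimpleGraph (Option V) :=
  SimpleGraph.fromRel (fun a b =>
    (∃ a' b' : V, a = some a' ∧ b = some b' ∧ (G.Adj a' b' ∨ (a' = v ∧ b' = w))) ∨
    (a = none ∧ ∃ u : V, b = some u ∧ (u = v ∨ u = w ∨ G.Adj v u ∨ G.Adj w u)))

/-- The weight function `ω⋆` on `G^⋆`: the new vertex `z⋆` gets weight `ω v + ω w`. -/
def starWeight {V : Type*} (ω : V → ℕ) (v w : V) : Option V → ℕ :=
  fun o => o.elim (ω v + ω w) ω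

/-- The coloring `κ⋆` of `G^⋆` induced by a coloring `κ` of `G`:
`κ⋆(z⋆) = κ(v) ∩ κ(w)`, `κ⋆(v) = κ(v) \ κ(w)`, `κ⋆(w) = κ(w) \ κ(v)`, and all
other color sets are kept. -/
def starColoring {V : Type*} [DecidableEq V] (v w : V) (κ : V → Finset ℕ) :
    Option V → Finset ℕ :=
  fun o => o.elim (κ v ∩ κ w)
    (fun u => if u = v then κ v \ κ w else if u = w then κ w \ κ v else κ u)

theorem Gstar_adj_some_some {V : Type*} (G : SimpleGraph V) {v w : V} (hvw : v ≠ w) (a b : V) :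
    (Gstar G v w).Adj (some a) (some b) ↔
      G.Adj a b ∨ (a = v ∧ b = w) ∨ (a = w ∧ b = v) := by
  have := G.adj_comm a b
  have := fun h : G.Adj a b => h.ne
  simp [Gstar, SimpleGraph.fromRel_adj]
  grind

theorem Gstar_adj_none_some {V : Type*} (G : SimpleGraph V) (v w u : V) :
    (Gstar G v w).Adj none (some u) ↔ u = v ∨ u = w ∨ G.Adj v u ∨ G.Adj w u := by
  simp [Gstar, SimpleGraph.fromRel_adj]

/-- A set coloring of `G⋆` is proper iff it is proper on the copy of `G` inside `G⋆` and on the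
additional edges. -/
theorem isProperSetColoring_Gstar_iff {V : Type*} (G : SimpleGraph V) {v w : V} (hvw : v ≠ w)
    (κ : Option V → Finset ℕ) :
    IsProperSetColoring (Gstar G v w) κ ↔
      (∀ o, (κ o).Nonempty) ∧ (∀ ⦃a b : V⦄, G.Adj a b → Disjoint (κ (some a)) (κ (some b))) ∧
      Disjoint (κ (some v)) (κ (some w)) ∧ Disjoint (κ none) (κ (some v)) ∧
      Disjoint (κ none) (κ (some w)) ∧
      ∀ u, G.Adj v u ∨ G.Adj w u → Disjoint (κ none) (κ (some u)) := by
  refine and_congr_right fun _ => ⟨fun h => ⟨?_, ?_, ?_, ?_, ?_⟩, ?_⟩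
  · exact fun a b hab => h ((Gstar_adj_some_some G hvw a b).2 (Or.inl hab))
  · exact h ((Gstar_adj_some_some G hvw v w).2 (by simp))
  · exact h ((Gstar_adj_none_some G v w v).2 (by simp))
  · exact h ((Gstar_adj_none_some G v w w).2 (by simp))
  · exact fun u hu => h ((Gstar_adj_none_some G v w u).2 (Or.inr (Or.inr hu)))
  · rintro ⟨hG, hv, hzv, hzw, hz⟩
    have hnone : ∀ u, (Gstar G v w).Adj none (some u) → Disjoint (κ none) (κ (some u)) := by
      intro u hu
      rcases (Gstar_adj_none_some G v w u).1 hu with rfl | rfl | hu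
      exacts [hzv, hzw, hz u hu]
    rintro (_ | a) (_ | b) hab
    · exact absurd rfl hab.ne
    · exact hnone b hab
    · exact (hnone a hab.symm).symm
    · rcases (Gstar_adj_some_some G hvw a b).1 hab with hab | ⟨rfl, rfl⟩ | ⟨rfl, rfl⟩
      exacts [hG hab, hv, hv.symm]

/-- The coloring of `G` obtained from a coloring of `G⋆` by adding the colors of the new vertex
to both `v` and `w`. -/
def unstarColoring {V : Type*} [DecidableEq V] (v w : V) (κ : Option V → Finset ℕ) :
    V → Finset ℕ :=
  fun u => if u = v ∨ u = w then κ (some u) ∪ κ none else κ (some u)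

theorem unstarColoring_starColoring {V : Type*} [DecidableEq V] (v w : V) (κ : V → Finset ℕ) :
    unstarColoring v w (starColoring v w κ) = κ := by
  funext u
  ext i
  simp only [unstarColoring, starColoring, Option.elim]
  grind

theorem starColoring_unstarColoring {V : Type*} [DecidableEq V] {v w : V}
    {κ : Option V → Finset ℕ} (h : Disjoint (κ (some v)) (κ (some w)))
    (hv : Disjoint (κ none) (κ (some v))) (hw : Disjoint (κ none) (κ (some w))) :
    starColoring v w (unstarColoring v w κ) = κ := by
  rw [Finset.disjoint_left] at h hv hw
  funext o
  ext i
  rcases o with _ | u <;> simp only [unstarColoring, starColoring, Option.elim] <;> grind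

theorem setColWeight_starColoring {V : Type*} [Fintype V] [DecidableEq V] (ω : V → ℕ) {v w : V}
    (hvw : v ≠ w) (κ : V → Finset ℕ) :
    setColWeight (starWeight ω v w) (starColoring v w κ) = setColWeight ω κ := by
  set f : Finset ℕ → ℕ →₀ ℕ := fun s => s.sum fun i => Finsupp.single i 1 with hf
  have hsplit : ∀ s t : Finset ℕ, f (s ∩ t) + f (s \ t) = f s := fun s t =>
    Finset.sum_inter_add_sum_sdiff s t _
  have key : ∀ u, ω u • f (κ u) = ω u • f (starColoring v w κ (some u)) +
      ((if u = v then ω v • f (κ v ∩ κ w) else 0) +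
        (if u = w then ω w • f (κ v ∩ κ w) else 0)) := by
    intro u
    rcases eq_or_ne u v with rfl | huv
    · simp [starColoring, hvw, ← smul_add, add_comm (f (κ u \ κ w)), hsplit]
    rcases eq_or_ne u w with rfl | huw
    · simp [starColoring, huv, ← smul_add, Finset.inter_comm (κ v), add_comm (f (κ u \ κ v)),
        hsplit]
    · simp [starColoring, huv, huw]
  change _ = ∑ u, ω u • f (κ u)
  simp only [key, Finset.sum_add_distrib, Finset.sum_ite_eq', Finset.mem_univ, if_true]
  rw [setColWeight, Fintype.sum_option, add_comm, ← add_smul]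
  rfl

theorem isProperSetColoring_starColoring {V : Type*} [DecidableEq V] {G : SimpleGraph V}
    {v w : V} (hvw : v ≠ w) {κ : V → Finset ℕ} (hκ : IsProperSetColoring G κ)
    (hz : (κ v ∩ κ w).Nonempty) (hv : (κ v \ κ w).Nonempty) (hw : (κ w \ κ v).Nonempty) :
    IsProperSetColoring (Gstar G v w) (starColoring v w κ) := by
  have hsub : ∀ u, starColoring v w κ (some u) ⊆ κ u := by
    intro u
    simp only [starColoring, Option.elim]
    grind
  rw [isProperSetColoring_Gstar_iff G hvw]
  refine ⟨?_, fun a b hab => (hκ.2 hab).mono (hsub a) (hsub b), ?_, ?_, ?_, ?_⟩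
  · rintro (_ | u)
    · exact hz
    · have := hκ.1 u
      simp only [starColoring, Option.elim]
      grind
  · simp only [starColoring, Option.elim, Finset.disjoint_left]
    grind
  · simp only [starColoring, Option.elim, Finset.disjoint_left]
    grind
  · simp only [starColoring, Option.elim, Finset.disjoint_left]
    grind
  · rintro u (hu | hu)
    · exact (hκ.2 hu).mono Finset.inter_subset_left (hsub u)
    · exact (hκ.2 hu).mono Finset.inter_subset_right (hsub u)

theorem isProperSetColoring_unstarColoring {V : Type*} [DecidableEq V] {G : SimpleGraph V}
    {v w : V} (hvw : v ≠ w) (hnadj : ¬ G.Adj v w) {κ : Option V → Finset ℕ}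
    (hκ : IsProperSetColoring (Gstar G v w) κ) :
    IsProperSetColoring G (unstarColoring v w κ) := by
  obtain ⟨hne, hG, -, -, -, hz⟩ := (isProperSetColoring_Gstar_iff G hvw κ).1 hκ
  refine ⟨fun u => ?_, fun a b hab => ?_⟩
  · have := hne (some u)
    simp only [unstarColoring]
    split_ifs
    exacts [this.inl, this]
  · have hab' := hG hab
    have hza : b = v ∨ b = w → Disjoint (κ none) (κ (some a)) := by
      rintro (rfl | rfl)
      exacts [hz a (Or.inl hab.symm), hz a (Or.inr hab.symm)]
    have hzb : a = v ∨ a = w → Disjoint (κ none) (κ (some b)) := by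
      rintro (rfl | rfl)
      exacts [hz b (Or.inl hab), hz b (Or.inr hab)]
    have hnot : ¬ ((a = v ∨ a = w) ∧ (b = v ∨ b = w)) := by
      rintro ⟨rfl | rfl, rfl | rfl⟩
      exacts [hab.ne rfl, hnadj hab, hnadj hab.symm, hab.ne rfl]
    simp only [unstarColoring]
    split_ifs with ha hb hb
    · exact absurd ⟨ha, hb⟩ hnot
    · exact Finset.disjoint_union_left.2 ⟨hab', hzb ha⟩
    · exact Finset.disjoint_union_right.2 ⟨hab', (hza hb).symm⟩
    · exact hab'

/-- `κ ↦ κ⋆` is a bijection from the proper set colorings of `G` for which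
`κ(v) ∩ κ(w)`, `κ(v) \ κ(w)`, `κ(w) \ κ(v)` are all nonempty onto all proper set
colorings of `G^⋆`, and it preserves the associated monomial. -/
theorem starColoring_bijection {V : Type*} [Fintype V] [DecidableEq V]
    (G : SimpleGraph V) (ω : V → ℕ) (v w : V) (hvw : v ≠ w) (hnadj : ¬ G.Adj v w) :
    Set.BijOn (starColoring v w)
      {κ : V → Finset ℕ | IsProperSetColoring G κ ∧
        (κ v ∩ κ w).Nonempty ∧ (κ v \ κ w).Nonempty ∧ (κ w \ κ v).Nonempty}
      {κ' | IsProperSetColoring (Gstar G v w) κ'} ∧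
    (∀ κ : V → Finset ℕ,
      (κ v ∩ κ w).Nonempty → (κ v \ κ w).Nonempty → (κ w \ κ v).Nonempty →
      setColWeight ω κ = setColWeight (starWeight ω v w) (starColoring v w κ)) := by
  refine ⟨⟨?_, ?_, ?_⟩, fun κ _ _ _ => (setColWeight_starColoring ω hvw κ).symm⟩
  · rintro κ ⟨hκ, hz, hv, hw⟩
    exact isProperSetColoring_starColoring hvw hκ hz hv hw
  · exact (Function.LeftInverse.injective (unstarColoring_starColoring v w)).injOn
  · intro κ hκ
    obtain ⟨hne, -, hd, hzv, hzw, -⟩ := (isProperSetColoring_Gstar_iff G hvw κ).1 hκ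
    have hright := starColoring_unstarColoring hd hzv hzw
    refine ⟨unstarColoring v w κ,
      ⟨isProperSetColoring_unstarColoring hvw hnadj hκ, ?_, ?_, ?_⟩, hright⟩
    · have hz := hne none
      rwa [← hright] at hz
    · have hv := hne (some v)
      rw [← hright] at hv
      simpa only [starColoring, Option.elim, if_true] using hv
    · have hw := hne (some w)
      rw [← hright] at hw
      simpa only [starColoring, Option.elim, hvw.symm, if_false, if_true] using hw
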